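/- For every affine-linear polynomial Q(x₁,x₂,x₃,x₄) with complex coefficients, i₂(δ_{x₁,x₂}(Q)) computed with respect to the pair of variables (x₃,x₄) equals i₂(δ_{x₃,x₄}(Q)) computed with respect to (x₁,x₂), and likewise i₃(δ_{x₁,x₂}(Q)) with respect to (x₃,x₄) equals i₃(δ_{x₃,x₄}(Q)) with respect to (x₁,x₂). -/

import Mathlib

open MvPolynomial

/-- `δ_{x_i,x_j}(Q) = Q_{x_i} Q_{x_j} - Q Q_{x_i x_j}`. -/
noncomputable def dd (i j : Fin 4) (Q : MvPolynomial (Fin 4) ℂ) : MvPolynomial (Fin 4) ℂ :=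
  pderiv i Q * pderiv j Q - Q * pderiv i (pderiv j Q)

/-- The relative invariant `i₂` of a biquadratic polynomial in the variables `x_i, x_j`:
`i₂ = 2 h h_{xxyy} - 2 h_x h_{xyy} - 2 h_y h_{xxy} + 2 h_{xx} h_{yy} + h_{xy}²`. -/
noncomputable def inv2 (i j : Fin 4) (h : MvPolynomial (Fin 4) ℂ) : MvPolynomial (Fin 4) ℂ :=
  2 * h * pderiv i (pderiv i (pderiv j (pderiv j h)))
    - 2 * pderiv i h * pderiv i (pderiv j (pderiv j h))
    - 2 * pderiv j h * pderiv i (pderiv i (pderiv j h))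
    + 2 * pderiv i (pderiv i h) * pderiv j (pderiv j h)
    + (pderiv i (pderiv j h)) ^ 2

/-- The relative invariant
`i₃ = (1/4)·det [[h, h_x, h_xx], [h_y, h_xy, h_xxy], [h_yy, h_xyy, h_xxyy]]`
of a biquadratic polynomial in the variables `x_i, x_j`. -/
noncomputable def inv3 (i j : Fin 4) (h : MvPolynomial (Fin 4) ℂ) : MvPolynomial (Fin 4) ℂ :=
  C (1 / 4 : ℂ) * Matrix.det
    !![h, pderiv i h, pderiv i (pderiv i h);
       pderiv j h, pderiv i (pderiv j h), pderiv i (pderiv i (pderiv j h));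
       pderiv j (pderiv j h), pderiv i (pderiv j (pderiv j h)),
         pderiv i (pderiv i (pderiv j (pderiv j h)))]

namespace MvPolynomial

variable {σ R : Type*} [CommSemiring R]

theorem pderiv_comm (i j : σ) (p : MvPolynomial σ R) :
    pderiv i (pderiv j p) = pderiv j (pderiv i p) := by
  classical
  ext m
  simp only [coeff_pderiv, Finsupp.add_apply]
  rw [add_right_comm]
  by_cases h : i = j
  · subst h; rfl
  · simp [h, Ne.symm h, mul_right_comm]

theorem pderiv_pderiv_eq_zero_of_degreeOf_le_one {i : σ} {p : MvPolynomial σ R}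
    (h : p.degreeOf i ≤ 1) : pderiv i (pderiv i p) = 0 := by
  ext m
  have hm : coeff (m + Finsupp.single i 1 + Finsupp.single i 1) p = 0 := by
    rw [← notMem_support_iff]
    refine notMem_support_of_degreeOf_lt i ?_
    simp
    omega
  simp [coeff_pderiv, hm]

end MvPolynomial

/-- For affine-linear `Q(x₁,x₂,x₃,x₄)` (variables indexed `0,1,2,3`),
`i_k(δ_{x₁,x₂}(Q), x₃, x₄) = i_k(δ_{x₃,x₄}(Q), x₁, x₂)` for `k = 2, 3`. -/
theorem statement1 (Q : MvPolynomial (Fin 4) ℂ) (hQ : ∀ i, Q.degreeOf i ≤ 1) :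
    inv2 2 3 (dd 0 1 Q) = inv2 0 1 (dd 2 3 Q) ∧
    inv3 2 3 (dd 0 1 Q) = inv3 0 1 (dd 2 3 Q) := by
  have hz : ∀ i, pderiv i (pderiv i Q) = 0 := fun i =>
    pderiv_pderiv_eq_zero_of_degreeOf_le_one (hQ i)
  have hz1 : ∀ i j, pderiv i (pderiv i (pderiv j Q)) = 0 := fun i j => by
    rw [pderiv_comm i j, pderiv_comm i j, hz, map_zero]
  have hz2 : ∀ i j k, pderiv i (pderiv i (pderiv j (pderiv k Q))) = 0 := fun i j k => by
    rw [pderiv_comm i j, pderiv_comm i j, hz1, map_zero]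
  have hz3 : ∀ i j k l, pderiv i (pderiv i (pderiv j (pderiv k (pderiv l Q)))) = 0 :=
    fun i j k l => by
      rw [pderiv_comm i j, pderiv_comm i j, hz2, map_zero]
  have c20 := pderiv_comm (R := ℂ) (2 : Fin 4) 0
  have c30 := pderiv_comm (R := ℂ) (3 : Fin 4) 0
  have c21 := pderiv_comm (R := ℂ) (2 : Fin 4) 1
  have c31 := pderiv_comm (R := ℂ) (3 : Fin 4) 1
  constructor
  · simp only [inv2, dd, map_sub, map_add, pderiv_mul, c20, c30, c21, c31, hz, hz1, hz2, hz3,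
      map_zero, mul_zero, zero_mul, add_zero, zero_add]
    ring
  · simp only [inv3, dd, Matrix.det_fin_three, Matrix.of_apply, Matrix.cons_val, map_sub, map_add,
      pderiv_mul, c20, c30, c21, c31, hz, hz1, hz2, hz3,
      map_zero, mul_zero, zero_mul, add_zero, zero_add]
    refine congrArg (C (1 / 4) * ·) ?_
    ring
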